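/- (Blum–Blum) If a family of c.e. sets is TxtEx-learned from computable enumerations by a computable learner M (i.e., M TxtEx-identifies every computable enumeration of every member of the family), then the family is TxtEx-learned from arbitrary enumerations by some computable learner. -/

import Mathlib

/-- `Wset e` is the `e`-th computably enumerable set: the domain of the `e`-th
partial computable function in the standard numbering by codes. -/
def Wset (e : ℕ) : Set ℕ :=
  {x | ((Denumerable.ofNat Nat.Partrec.Code e).eval x).Dom}

/-- The `i`-th column `{x : ⟨i,x⟩ ∈ W_a}` of the c.e. set coded by `a`;
the number `a` codes the u.c.e. family whose members are its columns. -/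
def column (a i : ℕ) : Set ℕ := {x | Nat.pair i x ∈ Wset a}

/-- The initial segment of length `n` of an enumeration `f`. -/
def initSeg (f : ℕ → ℕ) (n : ℕ) : List ℕ := (List.range n).map f

/-- The `m`-th computable learner in the standard effective enumeration of all
partial computable functions from finite sequences to ℕ. -/
def learnerOfCode (m : ℕ) : List ℕ →. ℕ :=
  fun σ => (Denumerable.ofNat Nat.Partrec.Code m).eval (Encodable.encode σ)

/-- `M` TxtFin-identifies the enumeration `f` (here `Option.none` plays the
role of the symbol `?`). -/
def TxtFinIdentifies (M : List ℕ →. Option ℕ) (f : ℕ → ℕ) : Prop :=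
  ∃ n h, (∀ n' < n, M (initSeg f n') = Part.some Option.none) ∧
    M (initSeg f n) = Part.some (Option.some h) ∧ Wset h = Set.range f

/-- `M` TxtFin-learns the set `S`. -/
def TxtFinLearnsSet (M : List ℕ →. Option ℕ) (S : Set ℕ) : Prop :=
  ∀ f : ℕ → ℕ, Set.range f = S → TxtFinIdentifies M f

/-- `M` TxtEx-identifies the enumeration `f`. -/
def TxtExIdentifies (M : List ℕ →. ℕ) (f : ℕ → ℕ) : Prop :=
  ∃ n, (∃ N, ∀ i ≥ N, M (initSeg f i) = Part.some n) ∧ Wset n = Set.range f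

/-- `M` TxtEx-learns the set `S`. -/
def TxtExLearnsSet (M : List ℕ →. ℕ) (S : Set ℕ) : Prop :=
  ∀ f : ℕ → ℕ, Set.range f = S → TxtExIdentifies M f

/-- `M` TxtBC-identifies the enumeration `f`. -/
def TxtBCIdentifies (M : List ℕ →. ℕ) (f : ℕ → ℕ) : Prop :=
  ∃ N, ∀ i ≥ N, ∃ h, M (initSeg f i) = Part.some h ∧ Wset h = Set.range f

/-- `M` TxtBC-learns the set `S`. -/
def TxtBCLearnsSet (M : List ℕ →. ℕ) (S : Set ℕ) : Prop :=
  ∀ f : ℕ → ℕ, Set.range f = S → TxtBCIdentifies M f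

/-- `M` TxtEx*-identifies the enumeration `f`. -/
def TxtExStarIdentifies (M : List ℕ →. ℕ) (f : ℕ → ℕ) : Prop :=
  ∃ n, (∃ N, ∀ i ≥ N, M (initSeg f i) = Part.some n) ∧
    (symmDiff (Wset n) (Set.range f)).Finite

/-- `M` TxtEx*-learns the set `S`. -/
def TxtExStarLearnsSet (M : List ℕ →. ℕ) (S : Set ℕ) : Prop :=
  ∀ f : ℕ → ℕ, Set.range f = S → TxtExStarIdentifies M f

/-- Indices of cofinite c.e. sets. -/
def COF : Set ℕ := {e | (Wset e)ᶜ.Finite}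

/-- Indices of coinfinite c.e. sets. -/
def COINF : Set ℕ := {e | (Wset e)ᶜ.Infinite}

/-- `P` is Σ⁰₃: definable by `∃∀∃` over a computable relation. -/
def IsSigma3 (P : Set ℕ) : Prop :=
  ∃ R : ℕ → ℕ → ℕ → ℕ → Bool,
    Computable (fun p : ℕ × ℕ × ℕ × ℕ => R p.1 p.2.1 p.2.2.1 p.2.2.2) ∧
    ∀ e, e ∈ P ↔ ∃ x, ∀ y, ∃ z, R e x y z = true

/-- `P` is Σ⁰₄: definable by `∃∀∃∀` over a computable relation. -/
def IsSigma4 (P : Set ℕ) : Prop :=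
  ∃ R : ℕ → ℕ → ℕ → ℕ → ℕ → Bool,
    Computable (fun p : ℕ × ℕ × ℕ × ℕ × ℕ =>
      R p.1 p.2.1 p.2.2.1 p.2.2.2.1 p.2.2.2.2) ∧
    ∀ e, e ∈ P ↔ ∃ x, ∀ y, ∃ z, ∀ w, R e x y z w = true

/-- `P` is Σ⁰₅: definable by `∃∀∃∀∃` over a computable relation. -/
def IsSigma5 (P : Set ℕ) : Prop :=
  ∃ R : ℕ → ℕ → ℕ → ℕ → ℕ → ℕ → Bool,
    Computable (fun p : ℕ × ℕ × ℕ × ℕ × ℕ × ℕ =>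
      R p.1 p.2.1 p.2.2.1 p.2.2.2.1 p.2.2.2.2.1 p.2.2.2.2.2) ∧
    ∀ e, e ∈ P ↔ ∃ x, ∀ y, ∃ z, ∀ w, ∃ v, R e x y z w v = true

/-- `f : ℕ → ℕ` is Δ⁰₂: the pointwise limit of a computable function. -/
def IsDelta2Fun (f : ℕ → ℕ) : Prop :=
  ∃ g : ℕ → ℕ → ℕ, Computable₂ g ∧ ∀ x, ∃ s₀, ∀ s ≥ s₀, g s x = f x

open Nat.Partrec (Code)

theorem initSeg_comp (g f : ℕ → ℕ) (n : ℕ) :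
    initSeg (g ∘ f) n = (initSeg f n).map g := by
  simp [initSeg]

@[simp] theorem length_initSeg (f : ℕ → ℕ) (n : ℕ) : (initSeg f n).length = n := by
  simp [initSeg]

theorem take_initSeg (f : ℕ → ℕ) {m n : ℕ} (h : m ≤ n) :
    (initSeg f n).take m = initSeg f m := by
  simp [initSeg, ← List.map_take, List.take_range, h]

theorem mem_initSeg {f : ℕ → ℕ} {n x : ℕ} : x ∈ initSeg f n ↔ ∃ i < n, f i = x := by
  simp [initSeg]

/-- A list contained in the content of a text is contained in some initial segment of it. -/
theorem exists_subset_initSeg (f : ℕ → ℕ) (l : List ℕ) (h : ∀ x ∈ l, x ∈ Set.range f) :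
    ∃ N, ∀ n ≥ N, l ⊆ initSeg f n := by
  induction l with
  | nil => exact ⟨0, by simp⟩
  | cons a l ih =>
    obtain ⟨N, hN⟩ := ih fun x hx => h x (List.mem_cons_of_mem _ hx)
    obtain ⟨i, hi⟩ := h a List.mem_cons_self
    refine ⟨max N (i + 1), fun n hn => List.cons_subset.2 ⟨?_, hN n (by omega)⟩⟩
    exact mem_initSeg.2 ⟨i, by omega, hi⟩

theorem subset_range_of_subset_initSeg {f : ℕ → ℕ} {l : List ℕ} {n : ℕ} (h : l ⊆ initSeg f n) :
    ∀ x ∈ l, x ∈ Set.range f := fun _ hx =>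
  let ⟨i, _, hi⟩ := mem_initSeg.1 (h hx)
  ⟨i, hi⟩

/-- The total learner that answers with the output of the code `c` on the longest prefix of its
input on which `c` halts within as many steps as the input has entries. -/
def delayedLearner (c : Code) (σ : List ℕ) : ℕ :=
  (c.evaln σ.length (Encodable.encode (σ.take
    (Nat.findGreatest
      (fun j => (c.evaln σ.length (Encodable.encode (σ.take j))).isSome = true) σ.length)))).getD 0

theorem primrec_delayedLearner (c : Code) : Primrec (delayedLearner c) := by
  have hev : Primrec₂ fun (σ : List ℕ) (j : ℕ) =>
      c.evaln σ.length (Encodable.encode (σ.take j)) :=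
    Code.primrec_evaln.comp
      (((Primrec.list_length.comp Primrec.fst).pair (Primrec.const c)).pair
        (Primrec.encode.comp (Primrec.list_take.comp Primrec.snd Primrec.fst)))
  have hfind : Primrec fun σ : List ℕ => Nat.findGreatest
      (fun j => (c.evaln σ.length (Encodable.encode (σ.take j))).isSome = true) σ.length :=
    Primrec.nat_findGreatest Primrec.list_length
      (Primrec.eq.comp (Primrec.option_isSome.comp hev) (Primrec.const true))
  exact Primrec.option_getD.comp (hev.comp Primrec.id hfind) (Primrec.const 0)

theorem delayedLearner_eventually {M : List ℕ →. ℕ} {c : Code}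
    (hc : ∀ σ, c.eval (Encodable.encode σ) = M σ) {f : ℕ → ℕ} {n N : ℕ}
    (hN : ∀ i ≥ N, M (initSeg f i) = Part.some n) :
    ∃ K, ∀ i ≥ K, delayedLearner c (initSeg f i) = n := by
  obtain ⟨k, hk⟩ : ∃ k, n ∈ c.evaln k (Encodable.encode (initSeg f N)) :=
    Code.evaln_complete.1 (by simp [hc, hN N le_rfl])
  refine ⟨max N k, fun i hi => ?_⟩
  have hNi : N ≤ i := by omega
  set P : ℕ → Prop := fun j => (c.evaln i (Encodable.encode ((initSeg f i).take j))).isSome = true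
    with hP
  have hPN : P N := by
    rw [hP]
    simp only [take_initSeg f hNi]
    exact Option.isSome_iff_exists.2 ⟨n, Code.evaln_mono (by omega) hk⟩
  set j := Nat.findGreatest P i with hj
  have hji : j ≤ i := Nat.findGreatest_le _
  have hNj : N ≤ j := Nat.le_findGreatest hNi hPN
  obtain ⟨m, hm⟩ := Option.isSome_iff_exists.1 (Nat.findGreatest_spec hNi hPN : P j)
  have hval : delayedLearner c (initSeg f i) = m := by
    simp only [delayedLearner, length_initSeg]
    change (c.evaln i (Encodable.encode ((initSeg f i).take j))).getD 0 = m
    rw [hm]; rfl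
  rw [hval]
  have := Code.evaln_sound hm
  rw [take_initSeg f hji, hc, hN j hNj] at this
  simpa using this

/-- If every computable surjective text makes `Q` converge, then `Q` has a locking sequence. -/
theorem exists_locking_of_converges {Q : List ℕ → ℕ} (hQ : Computable Q)
    (hconv : ∀ v : ℕ → ℕ, Computable v → Function.Surjective v →
      ∃ n N, ∀ i ≥ N, Q (initSeg v i) = n) :
    ∃ u, ∀ t, Q (u ++ t) = Q u := by
  by_contra! hex
  obtain ⟨next, hnextc, hnext⟩ :
      ∃ next : List ℕ → List ℕ, Computable next ∧ ∀ u, Q (u ++ next u) ≠ Q u := by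
    let p : List ℕ → ℕ → Bool := fun u t =>
      !decide (Q (u ++ (Denumerable.ofNat (List ℕ) t)) = Q u)
    have hp : Computable₂ p := by
      refine Primrec.not.to_comp.comp
        ((Primrec.eq (α := ℕ)).decide.to_comp.comp (hQ.comp ?_) (hQ.comp Computable.fst))
      exact Computable.list_append.comp Computable.fst
        ((Primrec.ofNat (List ℕ)).to_comp.comp Computable.snd)
    have hpex : ∀ u, ∃ t, p u t = true := fun u => by
      obtain ⟨t, ht⟩ := hex u
      exact ⟨Encodable.encode t, by simpa [p] using ht⟩
    have hr : Computable fun u => Nat.find (hpex u) := by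
      refine (Partrec.rfind hp.partrec₂).of_eq fun u => ?_
      refine Part.eq_some_iff.2 (Nat.mem_rfind.2 ⟨?_, fun {m} hm => ?_⟩)
      · simpa using (Nat.find_spec (hpex u)).symm
      · simpa using (Nat.find_min (hpex u) hm)
    refine ⟨fun u => Denumerable.ofNat (List ℕ) (Nat.find (hpex u)),
      (Primrec.ofNat (List ℕ)).to_comp.comp hr, fun u => ?_⟩
    have := Nat.find_spec (hpex u)
    simpa [p] using this
  let step : ℕ → List ℕ → List ℕ := fun k u => (u ++ [k]) ++ next (u ++ [k])
  let U : ℕ → List ℕ := fun n => Nat.rec [] step n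
  have hUs : ∀ k, U (k + 1) = (U k ++ [k]) ++ next (U k ++ [k]) := fun _ => rfl
  have hUc : Computable U := by
    have happ : Computable fun a : ℕ × ℕ × List ℕ => a.2.2 ++ [a.2.1] :=
      Computable.list_append.comp (Computable.snd.comp Computable.snd)
        (Computable.list_cons.comp (Computable.fst.comp Computable.snd) (Computable.const []))
    exact Computable.nat_rec Computable.id (Computable.const [])
      (Computable.list_append.comp happ (hnextc.comp happ)).to₂
  have hpre : ∀ {k m}, k ≤ m → U k <+: U m := fun {k m} h => by
    induction m, h using Nat.le_induction with
    | base => exact List.prefix_rfl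
    | succ m _ ih => exact ih.trans (by rw [hUs, List.append_assoc]; exact List.prefix_append _ _)
  have hlen : ∀ k, k ≤ (U k).length := fun k => by
    induction k with
    | zero => simp
    | succ k ih => rw [hUs]; simp; omega
  let v : ℕ → ℕ := fun n => ((U (n + 1))[n]?).getD 0
  have hvc : Computable v :=
    Computable.option_getD
      (Computable.list_getElem?.comp (hUc.comp Computable.succ) Computable.id) (Computable.const 0)
  have hget : ∀ k i (hi : i < (U k).length), (U k)[i]? = some (v i) := fun k i hi => by
    have hi' : i < (U (i + 1)).length := hlen (i + 1)
    have : (U k)[i]? = (U (i + 1))[i]? := by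
      rcases le_total k (i + 1) with h | h
      · exact (List.prefix_iff_getElem?.1 (hpre h) _ hi).symm ▸
          List.getElem?_eq_getElem hi
      · exact (List.prefix_iff_getElem?.1 (hpre h) _ hi').trans
          (List.getElem?_eq_getElem hi').symm
    rw [this]
    simp [v, List.getElem?_eq_getElem hi']
  have hseg : ∀ (k : ℕ) (l : List ℕ), l <+: U k → initSeg v l.length = l := fun k l hl => by
    refine List.ext_getElem? fun i => ?_
    by_cases hi : i < l.length
    · have h1 := hget k i (hi.trans_le hl.length_le)
      rw [List.prefix_iff_getElem?.1 hl _ hi] at h1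
      rw [List.getElem?_eq_getElem hi, h1]
      simp [initSeg, hi]
    · simp [initSeg, hi]
  have hvs : Function.Surjective v := fun k => by
    have hmem : k ∈ initSeg v (U (k + 1)).length := by
      rw [hseg (k + 1) _ List.prefix_rfl, hUs]; simp
    obtain ⟨i, -, hi⟩ := mem_initSeg.1 hmem
    exact ⟨i, hi⟩
  obtain ⟨n, N, hN⟩ := hconv v hvc hvs
  have hp1 : U N ++ [N] <+: U (N + 1) := by rw [hUs]; exact List.prefix_append _ _
  have h1 := hN (U N ++ [N]).length (by have := hlen N; simp; omega)
  have h2 := hN (U (N + 1)).length (by have := hlen (N + 1); omega)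
  rw [hseg (N + 1) _ hp1] at h1
  rw [hseg (N + 1) _ List.prefix_rfl, hUs] at h2
  exact hnext _ (h2.trans h1.symm)

/-- A nonempty c.e. set is the range of a computable function. -/
theorem exists_computable_range_eq_Wset (e : ℕ) (hne : (Wset e).Nonempty) :
    ∃ g : ℕ → ℕ, Computable g ∧ Set.range g = Wset e := by
  obtain ⟨x₀, hx₀⟩ := hne
  set c := Denumerable.ofNat Code e with hc
  let g : ℕ → ℕ := fun n =>
    bif (c.evaln n.unpair.1 n.unpair.2).isSome then n.unpair.2 else x₀
  have hgc : Primrec g := by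
    refine Primrec.cond (Primrec.option_isSome.comp (Code.primrec_evaln.comp
      (((Primrec.fst.comp Primrec.unpair).pair (Primrec.const c)).pair
        (Primrec.snd.comp Primrec.unpair)))) (Primrec.snd.comp Primrec.unpair) (Primrec.const x₀)
  refine ⟨g, hgc.to_comp, Set.Subset.antisymm ?_ fun x hx => ?_⟩
  · rintro _ ⟨n, rfl⟩
    by_cases hs : (c.evaln n.unpair.1 n.unpair.2).isSome
    · obtain ⟨y, hy⟩ := Option.isSome_iff_exists.1 hs
      have : g n = n.unpair.2 := by simp [g, hs]
      rw [this]
      exact Part.dom_iff_mem.2 ⟨y, Code.evaln_sound hy⟩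
    · have : g n = x₀ := by simp [g, hs]
      rwa [this]
  · obtain ⟨y, hy⟩ := Part.dom_iff_mem.1 (show (c.eval x).Dom from hx)
    obtain ⟨k, hk⟩ := Code.evaln_complete.1 hy
    refine ⟨Nat.pair k x, ?_⟩
    have : (c.evaln k x).isSome := Option.isSome_iff_exists.2 ⟨y, hk⟩
    simp [g, this]

/-- The data `ρ` refute that `σ` is a locking sequence of `L` for the presented set. -/
def Refuted (L : List ℕ → ℕ) (σ ρ : List ℕ) : Prop :=
  ¬ σ ⊆ ρ ∨ ∃ c < ρ.length, Denumerable.ofNat (List ℕ) c ⊆ ρ ∧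
    L (σ ++ Denumerable.ofNat (List ℕ) c) ≠ L σ

theorem primrecRel_subset : PrimrecRel fun σ ρ : List ℕ => σ ⊆ ρ := by
  have hmem : PrimrecRel fun (x : ℕ) (ρ : List ℕ) => x ∈ ρ :=
    ((Primrec.eq (α := ℕ)).exists_mem_list.comp Primrec.snd Primrec.fst).of_eq
      fun p => by simp
  exact hmem.forall_mem_list.of_eq fun _ _ => Iff.rfl

theorem primrecRel_refuted {L : List ℕ → ℕ} (hL : Primrec L) : PrimrecRel (Refuted L) := by
  have hsub := primrecRel_subset
  have hR : PrimrecRel fun (c : ℕ) (p : List ℕ × List ℕ) =>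
      Denumerable.ofNat (List ℕ) c ⊆ p.2 ∧ L (p.1 ++ Denumerable.ofNat (List ℕ) c) ≠ L p.1 := by
    have hc : Primrec fun q : ℕ × List ℕ × List ℕ => Denumerable.ofNat (List ℕ) q.1 :=
      (Primrec.ofNat (List ℕ)).comp Primrec.fst
    have hσ : Primrec fun q : ℕ × List ℕ × List ℕ => q.2.1 := Primrec.fst.comp Primrec.snd
    exact PrimrecPred.and (hsub.comp hc (Primrec.snd.comp Primrec.snd))
      (PrimrecPred.not (Primrec.eq.comp (hL.comp (Primrec.list_append.comp hσ hc)) (hL.comp hσ)))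
  have hE : PrimrecPred fun p : List ℕ × List ℕ => ∃ c < p.2.length,
      Denumerable.ofNat (List ℕ) c ⊆ p.2 ∧ L (p.1 ++ Denumerable.ofNat (List ℕ) c) ≠ L p.1 :=
    (hR.exists_mem_list.comp (Primrec.list_range.comp (Primrec.list_length.comp Primrec.snd))
      Primrec.id).of_eq fun p => by simp
  exact PrimrecPred.or (PrimrecPred.not (hsub.comp Primrec.fst Primrec.snd)) hE

open Classical in
/-- The learner that answers with the value of `L` at the first sequence not yet refuted. -/
noncomputable def lockingLearner (L : List ℕ → ℕ) (ρ : List ℕ) : ℕ :=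
  L (Denumerable.ofNat (List ℕ) ((List.range ρ.length).findIdx
    fun c => decide (¬ Refuted L (Denumerable.ofNat (List ℕ) c) ρ)))

theorem primrec_lockingLearner {L : List ℕ → ℕ} (hL : Primrec L) :
    Primrec (lockingLearner L) := by
  classical
  have hR : PrimrecRel fun (ρ : List ℕ) (c : ℕ) =>
      ¬ Refuted L (Denumerable.ofNat (List ℕ) c) ρ :=
    PrimrecPred.not ((primrecRel_refuted hL).comp
      ((Primrec.ofNat (List ℕ)).comp Primrec.snd) Primrec.fst)
  exact hL.comp ((Primrec.ofNat (List ℕ)).comp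
    (Primrec.list_findIdx (Primrec.list_range.comp Primrec.list_length) hR.decide))

/-- `σ` is a sequence over `S` no extension of which over `S` changes the answer of `L`. -/
def IsStabilizing (L : List ℕ → ℕ) (S : Set ℕ) (σ : List ℕ) : Prop :=
  (∀ x ∈ σ, x ∈ S) ∧ ∀ τ : List ℕ, (∀ x ∈ τ, x ∈ S) → L (σ ++ τ) = L σ

theorem IsStabilizing.not_refuted {L : List ℕ → ℕ} {f : ℕ → ℕ} {σ : List ℕ}
    (h : IsStabilizing L (Set.range f) σ) :
    ∃ N, ∀ n ≥ N, ¬ Refuted L σ (initSeg f n) := by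
  obtain ⟨N, hN⟩ := exists_subset_initSeg f σ h.1
  refine ⟨N, fun n hn => ?_⟩
  rintro (hs | ⟨c, -, hc, hne⟩)
  · exact hs (hN n hn)
  · exact hne (h.2 _ (subset_range_of_subset_initSeg hc))

theorem refuted_of_not_isStabilizing {L : List ℕ → ℕ} {f : ℕ → ℕ} {σ : List ℕ}
    (h : ¬ IsStabilizing L (Set.range f) σ) :
    ∃ N, ∀ n ≥ N, Refuted L σ (initSeg f n) := by
  by_cases hσ : ∀ x ∈ σ, x ∈ Set.range f
  · obtain ⟨τ, hτ, hne⟩ : ∃ τ : List ℕ, (∀ x ∈ τ, x ∈ Set.range f) ∧ L (σ ++ τ) ≠ L σ := by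
      by_contra! hcon
      exact h ⟨hσ, hcon⟩
    obtain ⟨N, hN⟩ := exists_subset_initSeg f τ hτ
    refine ⟨max N (Encodable.encode τ + 1), fun n hn => Or.inr ⟨Encodable.encode τ, ?_, ?_, ?_⟩⟩
    · rw [length_initSeg]; omega
    · simpa using hN n (by omega)
    · simpa using hne
  · exact ⟨0, fun n _ => Or.inl fun hs => hσ (subset_range_of_subset_initSeg hs)⟩

theorem lockingLearner_eventually {L : List ℕ → ℕ} {f : ℕ → ℕ}
    (hex : ∃ σ, IsStabilizing L (Set.range f) σ) :
    ∃ σ, IsStabilizing L (Set.range f) σ ∧ ∃ N, ∀ n ≥ N, lockingLearner L (initSeg f n) = L σ := by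
  classical
  have hex' : ∃ c, IsStabilizing L (Set.range f) (Denumerable.ofNat (List ℕ) c) := by
    obtain ⟨σ, hσ⟩ := hex
    exact ⟨Encodable.encode σ, by simpa using hσ⟩
  set c := Nat.find hex' with hc
  have hst := Nat.find_spec hex'
  rw [← hc] at hst
  obtain ⟨N₀, hN₀⟩ := hst.not_refuted
  have hlt : ∀ d < c, ∃ N, ∀ n ≥ N,
      Refuted L (Denumerable.ofNat (List ℕ) d) (initSeg f n) := fun d hd =>
    refuted_of_not_isStabilizing (Nat.find_min hex' hd)
  choose! B hB using hlt
  refine ⟨_, hst, max (max N₀ (c + 1)) ((Finset.range c).sup B), fun n hn => ?_⟩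
  have hn0 : N₀ ≤ n := by omega
  have hcn : c < n := by omega
  have hsup : (Finset.range c).sup B ≤ n := by omega
  have hidx : (List.range n).findIdx (fun c =>
      decide (¬ Refuted L (Denumerable.ofNat (List ℕ) c) (initSeg f n))) = c := by
    refine (List.findIdx_eq (by simpa using hcn)).2 ⟨by simpa using hN₀ n hn0, fun d hd => ?_⟩
    simpa using hB d hd n ((Finset.le_sup (Finset.mem_range.2 hd)).trans hsup)
  simp only [lockingLearner, length_initSeg, hidx]

/-- The text that starts with the entries of `σ` and continues with `g`. -/
def prependText (σ : List ℕ) (g : ℕ → ℕ) (n : ℕ) : ℕ := (σ[n]?).getD (g (n - σ.length))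

theorem computable_prependText (σ : List ℕ) {g : ℕ → ℕ} (hg : Computable g) :
    Computable (prependText σ g) :=
  Computable.option_getD (Computable.list_getElem?.comp (Computable.const σ) Computable.id)
    (hg.comp (Primrec.nat_sub.to_comp.comp Computable.id (Computable.const _)))

theorem initSeg_prependText (σ : List ℕ) (g : ℕ → ℕ) (n : ℕ) :
    initSeg (prependText σ g) (σ.length + n) = σ ++ initSeg g n := by
  refine List.ext_getElem (by simp) fun i h1 h2 => ?_
  by_cases hi : i < σ.length
  · simp [initSeg, prependText, hi]
  · simp [initSeg, prependText, List.getElem_append_right (not_lt.1 hi),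
      List.getElem?_eq_none (not_lt.1 hi)]

theorem range_prependText {σ : List ℕ} {g : ℕ → ℕ} (h : ∀ x ∈ σ, x ∈ Set.range g) :
    Set.range (prependText σ g) = Set.range g := by
  refine Set.Subset.antisymm ?_ ?_
  · rintro _ ⟨n, rfl⟩
    by_cases hn : n < σ.length
    · simpa [prependText, hn] using h _ (List.getElem_mem hn)
    · exact ⟨n - σ.length, by simp [prependText, List.getElem?_eq_none (not_lt.1 hn)]⟩
  · rintro _ ⟨n, rfl⟩
    exact ⟨σ.length + n, by simp [prependText]⟩

/-- Mapping a computable function over a list is computable. -/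
theorem computable_list_map {g : ℕ → ℕ} (hg : Computable g) :
    Computable fun l : List ℕ => l.map g := by
  let F : List ℕ → ℕ → List ℕ := fun l n =>
    Nat.rec [] (fun k IH => IH ++ [g ((l[k]?).getD 0)]) n
  have hF : Computable fun l : List ℕ => F l l.length := by
    refine Computable.nat_rec Computable.list_length (Computable.const ([] : List ℕ))
      (h := fun l p => p.2 ++ [g ((l[p.1]?).getD 0)]) ?_
    refine Computable.list_append.comp (Computable.snd.comp Computable.snd)
      (Computable.list_cons.comp (hg.comp (Computable.option_getD (Computable.list_getElem?.comp
        Computable.fst (Computable.fst.comp Computable.snd)) (Computable.const 0)))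
        (Computable.const []))
  refine hF.of_eq fun l => ?_
  have key : ∀ n ≤ l.length, F l n = (l.take n).map g := fun n => by
    induction n with
    | zero => intro _; simp [F]
    | succ n ih =>
      intro hn
      have : F l (n + 1) = F l n ++ [g ((l[n]?).getD 0)] := rfl
      rw [this, ih (by omega), List.take_succ_eq_append_getElem (by omega), List.map_append]
      rw [List.getElem?_eq_getElem (show n < l.length by omega)]
      rfl
  simpa using key l.length le_rfl

/-- Blum–Blum: a family of c.e. sets TxtEx-learned from computable enumerations
by a computable learner is TxtEx-learned from arbitrary enumerations by some
computable learner. -/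
theorem blum_blum (F : Set (Set ℕ)) (hF : ∀ S ∈ F, ∃ e, S = Wset e)
    (M : List ℕ →. ℕ) (hM : Partrec M)
    (h : ∀ S ∈ F, ∀ f : ℕ → ℕ, Computable f → Set.range f = S →
      TxtExIdentifies M f) :
    ∃ N : List ℕ →. ℕ, Partrec N ∧ ∀ S ∈ F, TxtExLearnsSet N S := by
  obtain ⟨c, hc⟩ := Code.exists_code.1 hM
  have hc' : ∀ σ, c.eval (Encodable.encode σ) = M σ := fun σ => by
    simp [hc, Part.map_id']
  set L := delayedLearner c
  have hL : Primrec L := primrec_delayedLearner c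
  refine ⟨fun ρ => Part.some (lockingLearner L ρ), (primrec_lockingLearner hL).to_comp, ?_⟩
  intro S hS f hf
  obtain ⟨e, he⟩ := hF S hS
  obtain ⟨g, hg, hgS⟩ := exists_computable_range_eq_Wset e ⟨f 0, he ▸ hf ▸ ⟨0, rfl⟩⟩
  rw [← he] at hgS
  obtain ⟨u, hu⟩ : ∃ u : List ℕ, ∀ t : List ℕ, L ((u ++ t).map g) = L (u.map g) := by
    refine exists_locking_of_converges (Q := fun u => L (u.map g)) ?_ fun v hv hvs => ?_
    · exact hL.to_comp.comp (computable_list_map hg)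
    · obtain ⟨n, ⟨N, hN⟩, -⟩ := h S hS (g ∘ v) (hg.comp hv) (by rw [hvs.range_comp, hgS])
      obtain ⟨K, hK⟩ := delayedLearner_eventually hc' hN
      exact ⟨n, K, fun i hi => by rw [← initSeg_comp]; exact hK i hi⟩
  have hex : IsStabilizing L (Set.range f) (u.map g) := by
    rw [hf, ← hgS]
    refine ⟨by simp, fun τ hτ => ?_⟩
    obtain ⟨t, rfl⟩ : ∃ t, List.map g t = τ := by
      rwa [← Set.mem_range, Set.range_list_map]
    rw [← List.map_append]
    exact hu t
  obtain ⟨σ, hσ, N, hN⟩ := lockingLearner_eventually ⟨_, hex⟩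
  refine ⟨L σ, ⟨N, fun i hi => congrArg Part.some (hN i hi)⟩, ?_⟩
  rw [hf, ← hgS] at hσ
  obtain ⟨n, ⟨N', hN'⟩, hn⟩ := h S hS (prependText σ g) (computable_prependText σ hg)
    ((range_prependText hσ.1).trans hgS)
  obtain ⟨K, hK⟩ := delayedLearner_eventually hc' hN'
  have hval : L σ = n := by
    rw [← hK (σ.length + K) (by omega), initSeg_prependText]
    exact (hσ.2 _ (subset_range_of_subset_initSeg (List.Subset.refl (initSeg g K)))).symm
  rw [hval, hn, range_prependText hσ.1, hgS, hf]
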